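/- Joined crossings of overlapping squares yield long vertical crossings (Lemma 5.5): For every ε ∈ (0,1] and c' > 0 there is c > 0 such that the following holds for every integer n ≥ 1. Set h = ⌈εn⌉, S_1 = [0,n]×[0,n] and S_2 = [0,n]×[h, n+h], and let J(S_1,S_2) be the event that there exist an open horizontal crossing P_1 of S_1, an open horizontal crossing P_2 of S_2, and an open lattice path all of whose vertices have x-coordinate between 0 and n which starts at a vertex of P_1 and ends at a vertex of P_2 (this includes the case where P_1 and P_2 share a vertex). If Pr(J(S_1,S_2)) ≥ c', then Pr(V([0,n]×[0,100n])) ≥ c. -/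

import Mathlib

open MeasureTheory

/-- A bond of the grid `ℤ²`: `(v, true)` is the bond joining `v` to `v + (1,0)`,
and `(v, false)` is the bond joining `v` to `v + (0,1)`. -/
abbrev GridBond : Type := (ℤ × ℤ) × Bool

/-- A percolation configuration: each bond is open (`true`) or closed (`false`). -/
abbrev PercCfg : Type := GridBond → Bool

/-- The vertices `u` and `v` are adjacent in `ℤ²` and the bond joining them is
open in the configuration `ω`. -/
def BondOpen (ω : PercCfg) (u v : ℤ × ℤ) : Prop :=
  (v = (u.1 + 1, u.2) ∧ ω (u, true) = true) ∨
  (u = (v.1 + 1, v.2) ∧ ω (v, true) = true) ∨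
  (v = (u.1, u.2 + 1) ∧ ω (u, false) = true) ∨
  (u = (v.1, v.2 + 1) ∧ ω (v, false) = true)

/-- `v` lies in the rectangle `[a,b] × [c,d]` of `ℤ²`. -/
def InRect (a b c d : ℤ) (v : ℤ × ℤ) : Prop :=
  a ≤ v.1 ∧ v.1 ≤ b ∧ c ≤ v.2 ∧ v.2 ≤ d

/-- `Pth 0, Pth 1, …, Pth k` is an open lattice path in the rectangle
`[a,b] × [c,d]`. -/
def OpenPathIn (ω : PercCfg) (a b c d : ℤ) (k : ℕ) (Pth : ℕ → ℤ × ℤ) : Prop :=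
  (∀ i ≤ k, InRect a b c d (Pth i)) ∧ ∀ i < k, BondOpen ω (Pth i) (Pth (i + 1))

/-- The event that `[a,b] × [c,d]` has an open horizontal crossing. -/
def HCross (a b c d : ℤ) : Set PercCfg :=
  {ω | ∃ k Pth, OpenPathIn ω a b c d k Pth ∧ (Pth 0).1 = a ∧ (Pth k).1 = b}

/-- The event that `[a,b] × [c,d]` has an open vertical crossing. -/
def VCross (a b c d : ℤ) : Set PercCfg :=
  {ω | ∃ k Pth, OpenPathIn ω a b c d k Pth ∧ (Pth 0).2 = c ∧ (Pth k).2 = d}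

/-- `Pr` is the i.i.d. Bernoulli(1/2) bond percolation measure on `ℤ²`: a
probability measure under which the states of the bonds are independent, each
open with probability `1/2`. -/
def IsBondPerc (Pr : Measure PercCfg) : Prop :=
  IsProbabilityMeasure Pr ∧
    ∀ (s : Finset GridBond) (f : GridBond → Bool),
      Pr {ω | ∀ e ∈ s, ω e = f e} = (1 / 2 : ENNReal) ^ s.card

/-- A property of configurations is *witnessed* if, whenever it holds, it is forced by finitely
many open bonds. -/
def Witnessed (p : PercCfg → Prop) : Prop :=
  ∀ ω, p ω → ∃ s : Finset GridBond, (∀ e ∈ s, ω e = true) ∧ ∀ ω', (∀ e ∈ s, ω' e = true) → p ω'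

namespace Witnessed

theorem const (p : Prop) : Witnessed fun _ => p :=
  fun _ h => ⟨∅, by simp, fun _ _ => h⟩

theorem bond (e : GridBond) : Witnessed fun ω => ω e = true :=
  fun _ h => ⟨{e}, by simpa using h, fun _ h' => h' e (by simp)⟩

theorem and {p q : PercCfg → Prop} (hp : Witnessed p) (hq : Witnessed q) :
    Witnessed fun ω => p ω ∧ q ω := by
  classical
  rintro ω ⟨h₁, h₂⟩
  obtain ⟨s, hs, hs'⟩ := hp ω h₁
  obtain ⟨t, ht, ht'⟩ := hq ω h₂
  refine ⟨s ∪ t, fun e he => (Finset.mem_union.1 he).elim (hs e) (ht e), fun ω' h => ⟨?_, ?_⟩⟩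
  · exact hs' _ fun e he => h e (Finset.mem_union_left _ he)
  · exact ht' _ fun e he => h e (Finset.mem_union_right _ he)

theorem or {p q : PercCfg → Prop} (hp : Witnessed p) (hq : Witnessed q) :
    Witnessed fun ω => p ω ∨ q ω := by
  rintro ω (h | h)
  · obtain ⟨s, hs, hs'⟩ := hp ω h
    exact ⟨s, hs, fun ω' h' => Or.inl (hs' ω' h')⟩
  · obtain ⟨s, hs, hs'⟩ := hq ω h
    exact ⟨s, hs, fun ω' h' => Or.inr (hs' ω' h')⟩

theorem exists_of {α : Sort*} {p : α → PercCfg → Prop} (hp : ∀ a, Witnessed (p a)) :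
    Witnessed fun ω => ∃ a, p a ω := by
  rintro ω ⟨a, h⟩
  obtain ⟨s, hs, hs'⟩ := hp a ω h
  exact ⟨s, hs, fun ω' h' => ⟨a, hs' ω' h'⟩⟩

theorem forall_lt {p : ℕ → PercCfg → Prop} (hp : ∀ i, Witnessed (p i)) (k : ℕ) :
    Witnessed fun ω => ∀ i < k, p i ω := by
  induction k with
  | zero => simpa using const True
  | succ k ih =>
    have : (fun ω => ∀ i < k + 1, p i ω) = fun ω => (∀ i < k, p i ω) ∧ p k ω := by
      funext ω
      simp only [Nat.forall_lt_succ_right]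
    rw [this]
    exact ih.and (hp k)

theorem bondOpen (u v : ℤ × ℤ) : Witnessed fun ω => BondOpen ω u v :=
  ((const _).and (bond _)).or <| ((const _).and (bond _)).or <|
    ((const _).and (bond _)).or ((const _).and (bond _))

theorem openPathIn (a b c d : ℤ) (k : ℕ) (P : ℕ → ℤ × ℤ) :
    Witnessed fun ω => OpenPathIn ω a b c d k P :=
  (const _).and (forall_lt (fun _ => bondOpen _ _) k)

theorem vCross (a b c d : ℤ) : Witnessed fun ω => ω ∈ VCross a b c d :=
  exists_of fun _ => exists_of fun _ => (openPathIn _ _ _ _ _ _).and (const _)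

theorem hCross (a b c d : ℤ) : Witnessed fun ω => ω ∈ HCross a b c d :=
  exists_of fun _ => exists_of fun _ => (openPathIn _ _ _ _ _ _).and (const _)

end Witnessed

theorem measurableSet_cylinder (s : Finset GridBond) (f : GridBond → Bool) :
    MeasurableSet {ω : PercCfg | ∀ e ∈ s, ω e = f e} := by
  have : {ω : PercCfg | ∀ e ∈ s, ω e = f e} = ⋂ e ∈ s, (fun ω => ω e) ⁻¹' {f e} := by
    ext ω; simp
  rw [this]
  exact Finset.measurableSet_biInter _ fun e _ => measurable_pi_apply e (measurableSet_singleton _)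

/-- The configurations for which the open bonds of `s` alone force `p`. -/
def forcedBy (p : PercCfg → Prop) (s : Finset GridBond) : Set PercCfg :=
  {ω | ∀ ω', (∀ e ∈ s, ω e = true → ω' e = true) → p ω'}

theorem forcedBy_mono (p : PercCfg → Prop) : Monotone (forcedBy p) :=
  fun _ _ hst _ hω ω' h' => hω ω' fun e he => h' e (hst he)

theorem Witnessed.setOf_eq_iUnion {p : PercCfg → Prop} (hp : Witnessed p) :
    {ω | p ω} = ⋃ s, forcedBy p s := by
  ext ω
  simp only [Set.mem_ofPred_eq, Set.mem_iUnion]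
  constructor
  · intro h
    obtain ⟨s, hs, hs'⟩ := hp ω h
    exact ⟨s, fun ω' h' => hs' ω' fun e he => h' e he (hs e he)⟩
  · rintro ⟨s, hs⟩
    exact hs ω fun _ _ h => h

theorem Witnessed.measure_eq_iSup {p : PercCfg → Prop} (hp : Witnessed p) (μ : Measure PercCfg) :
    μ {ω | p ω} = ⨆ s, μ (forcedBy p s) := by
  rw [hp.setOf_eq_iUnion]
  exact (forcedBy_mono p).directed_le.measure_iUnion

open Classical in
/-- The sets `T ⊆ s` of bonds whose openness forces `p`. -/
noncomputable def forcingSets (p : PercCfg → Prop) (s : Finset GridBond) : Finset (Finset s) :=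
  Finset.univ.filter fun T => ∀ ω : PercCfg, (∀ e ∈ T, ω e = true) → p ω

open Classical in
/-- The configurations whose set of open bonds in `s` is exactly `T`. -/
def exactlyOpen (s : Finset GridBond) (T : Finset s) : Set PercCfg :=
  {ω | ∀ e ∈ s, ω e = decide (∃ h : e ∈ s, (⟨e, h⟩ : s) ∈ T)}

theorem mem_exactlyOpen {s : Finset GridBond} {T : Finset s} {ω : PercCfg} :
    ω ∈ exactlyOpen s T ↔ ∀ e : s, ω e = true ↔ e ∈ T := by
  classical
  simp only [exactlyOpen, Set.mem_ofPred_eq, Subtype.forall]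
  refine forall₂_congr fun e he => ?_
  rw [Bool.eq_iff_iff]
  simp [he]

theorem forcedBy_eq_biUnion (p : PercCfg → Prop) (s : Finset GridBond) :
    forcedBy p s = ⋃ T ∈ forcingSets p s, exactlyOpen s T := by
  classical
  ext ω
  simp only [Set.mem_iUnion, mem_exactlyOpen, forcingSets, Finset.mem_filter, Finset.mem_univ,
    true_and, exists_prop]
  constructor
  · intro h
    refine ⟨Finset.univ.filter fun e : s => ω e = true, fun ω' h' => h ω' fun e he hω => ?_,
      fun e => by simp⟩
    exact h' ⟨e, he⟩ (by simpa using hω)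
  · rintro ⟨T, hT, hω⟩ ω' h'
    exact hT ω' fun e he => h' e e.2 ((hω e).2 he)

theorem measurableSet_exactlyOpen (s : Finset GridBond) (T : Finset s) :
    MeasurableSet (exactlyOpen s T) :=
  measurableSet_cylinder s _

theorem measurableSet_forcedBy (p : PercCfg → Prop) (s : Finset GridBond) :
    MeasurableSet (forcedBy p s) := by
  rw [forcedBy_eq_biUnion]
  exact Finset.measurableSet_biUnion _ fun T _ => measurableSet_exactlyOpen s T

theorem Witnessed.measurableSet {p : PercCfg → Prop} (hp : Witnessed p) :
    MeasurableSet {ω | p ω} := by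
  rw [hp.setOf_eq_iUnion]
  exact MeasurableSet.iUnion fun s => measurableSet_forcedBy p s

theorem IsBondPerc.measure_forcedBy {Pr : Measure PercCfg} (hPr : IsBondPerc Pr)
    (p : PercCfg → Prop) (s : Finset GridBond) :
    Pr (forcedBy p s) = (forcingSets p s).card * (1 / 2 : ENNReal) ^ s.card := by
  rw [forcedBy_eq_biUnion, measure_biUnion_finset]
  · have hT : ∀ T, Pr (exactlyOpen s T) = (1 / 2 : ENNReal) ^ s.card := fun T => hPr.2 s _
    simp only [hT, Finset.sum_const, nsmul_eq_mul]
  · intro T _ T' _ hne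
    refine Set.disjoint_left.2 fun ω h h' => hne ?_
    ext e
    rw [← mem_exactlyOpen.1 h e, mem_exactlyOpen.1 h' e]
  · exact fun T _ => measurableSet_exactlyOpen s T

/-- Any two bond percolation measures agree on witnessed events. -/
theorem IsBondPerc.measure_eq {μ ν : Measure PercCfg} (hμ : IsBondPerc μ) (hν : IsBondPerc ν)
    {p : PercCfg → Prop} (hp : Witnessed p) : μ {ω | p ω} = ν {ω | p ω} := by
  simp only [hp.measure_eq_iSup, hμ.measure_forcedBy, hν.measure_forcedBy]

theorem isUpperSet_forcingSets (p : PercCfg → Prop) (s : Finset GridBond) :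
    IsUpperSet (forcingSets p s : Set (Finset s)) := by
  intro T T' hTT' hT
  simp only [forcingSets, Finset.coe_filter, Finset.mem_univ, true_and, Set.mem_ofPred_eq] at hT ⊢
  exact fun ω h => hT ω fun e he => h e (hTT' he)

theorem IsBondPerc.harris_forcedBy {Pr : Measure PercCfg} (hPr : IsBondPerc Pr)
    (p q : PercCfg → Prop) (s : Finset GridBond) :
    Pr (forcedBy p s) * Pr (forcedBy q s) ≤ Pr (forcedBy (fun ω => p ω ∧ q ω) s) := by
  classical
  have hinter : forcingSets (fun ω => p ω ∧ q ω) s = forcingSets p s ∩ forcingSets q s := by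
    ext T
    simp only [forcingSets, Finset.mem_inter, Finset.mem_filter, Finset.mem_univ, true_and]
    exact ⟨fun h => ⟨fun ω' h' => (h ω' h').1, fun ω' h' => (h ω' h').2⟩,
      fun h ω' h' => ⟨h.1 ω' h', h.2 ω' h'⟩⟩
  have hcard := (isUpperSet_forcingSets p s).le_card_inter_finset (isUpperSet_forcingSets q s)
  rw [Fintype.card_coe, ← hinter] at hcard
  have hcard' : ((forcingSets p s).card : ENNReal) * (forcingSets q s).card ≤
      2 ^ s.card * (forcingSets (fun ω => p ω ∧ q ω) s).card := by exact_mod_cast hcard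
  simp only [hPr.measure_forcedBy]
  have hone : (2 : ENNReal) ^ s.card * (1 / 2 : ENNReal) ^ s.card = 1 := by
    rw [← mul_pow, one_div, ENNReal.mul_inv_cancel (by simp) (by simp), one_pow]
  calc _ = ((forcingSets p s).card * (forcingSets q s).card : ENNReal) *
        ((1 / 2) ^ s.card * (1 / 2) ^ s.card) := by ring
    _ ≤ (2 ^ s.card * (forcingSets (fun ω => p ω ∧ q ω) s).card) *
        ((1 / 2) ^ s.card * (1 / 2) ^ s.card) := by gcongr
    _ = (2 ^ s.card * (1 / 2) ^ s.card) *
        ((forcingSets (fun ω => p ω ∧ q ω) s).card * (1 / 2) ^ s.card) := by ring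
    _ = _ := by rw [hone, one_mul]

/-- The **Harris inequality** for witnessed (hence increasing) events. -/
theorem IsBondPerc.harris {Pr : Measure PercCfg} (hPr : IsBondPerc Pr) {p q : PercCfg → Prop}
    (hp : Witnessed p) (hq : Witnessed q) :
    Pr {ω | p ω} * Pr {ω | q ω} ≤ Pr {ω | p ω ∧ q ω} := by
  classical
  rw [hp.measure_eq_iSup, hq.measure_eq_iSup, (hp.and hq).measure_eq_iSup]
  simp only [ENNReal.iSup_mul, ENNReal.mul_iSup]
  refine iSup_le fun t => iSup_le fun s => le_iSup_of_le (s ∪ t) ?_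
  refine le_trans ?_ (hPr.harris_forcedBy p q _)
  gcongr
  · exact forcedBy_mono p Finset.subset_union_left
  · exact forcedBy_mono q Finset.subset_union_right

theorem IsBondPerc.harris_forall_lt {Pr : Measure PercCfg} (hPr : IsBondPerc Pr)
    {p : ℕ → PercCfg → Prop} (hp : ∀ i, Witnessed (p i)) {c : ENNReal}
    (hc : ∀ i, c ≤ Pr {ω | p i ω}) (k : ℕ) : c ^ k ≤ Pr {ω | ∀ i < k, p i ω} := by
  induction k with
  | zero =>
    have := hPr.1
    simp
  | succ k ih =>
    simp only [Nat.forall_lt_succ_right]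
    calc c ^ (k + 1) = c ^ k * c := pow_succ _ _
      _ ≤ Pr {ω | ∀ i < k, p i ω} * Pr {ω | p k ω} := by gcongr; exact hc k
      _ ≤ _ := hPr.harris (.forall_lt hp k) (hp k)

/-- Relabelling the bonds does not change the probability of a witnessed event. -/
theorem IsBondPerc.measure_comp {Pr : Measure PercCfg} (hPr : IsBondPerc Pr)
    (φ : GridBond ≃ GridBond) {p : PercCfg → Prop} (hp : Witnessed p) :
    Pr {ω | p (ω ∘ φ)} = Pr {ω | p ω} := by
  have := hPr.1
  have hm : Measurable fun ω : PercCfg => (ω ∘ φ : PercCfg) :=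
    measurable_pi_lambda _ fun e => measurable_pi_apply (φ e)
  have hν : IsBondPerc (Pr.map fun ω : PercCfg => (ω ∘ φ : PercCfg)) := by
    refine ⟨Measure.isProbabilityMeasure_map hm.aemeasurable, fun s f => ?_⟩
    rw [Measure.map_apply hm (measurableSet_cylinder s f)]
    have h := hPr.2 (s.map φ.toEmbedding) (f ∘ φ.symm)
    rw [Finset.card_map] at h
    rw [← h]
    congr 1
    ext ω
    simp only [Set.mem_preimage, Set.mem_ofPred_eq, Finset.forall_mem_map, Function.comp_apply,
      Equiv.coe_toEmbedding, Equiv.symm_apply_apply]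
  rw [← hν.measure_eq hPr hp, Measure.map_apply hm hp.measurableSet]
  rfl

/-- The vertical translation of bonds by `s`. -/
def bondShift (s : ℤ) : GridBond ≃ GridBond where
  toFun e := ((e.1.1, e.1.2 + s), e.2)
  invFun e := ((e.1.1, e.1.2 - s), e.2)
  left_inv e := by simp
  right_inv e := by simp

/-- The reflection of bonds in the diagonal. -/
def bondSwap : GridBond ≃ GridBond where
  toFun e := (e.1.swap, !e.2)
  invFun e := (e.1.swap, !e.2)
  left_inv e := by simp
  right_inv e := by simp

theorem BondOpen.of_shift {ω : PercCfg} {s : ℤ} {u v : ℤ × ℤ}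
    (h : BondOpen (ω ∘ bondShift s) u v) : BondOpen ω (u.1, u.2 + s) (v.1, v.2 + s) := by
  obtain ⟨u₁, u₂⟩ := u
  obtain ⟨v₁, v₂⟩ := v
  simp only [BondOpen, bondShift, Function.comp_apply, Equiv.coe_fn_mk, Prod.mk.injEq] at h ⊢
  rcases h with ⟨⟨rfl, rfl⟩, h⟩ | ⟨⟨rfl, rfl⟩, h⟩ | ⟨⟨rfl, rfl⟩, h⟩ | ⟨⟨rfl, rfl⟩, h⟩
  · exact Or.inl ⟨⟨rfl, rfl⟩, h⟩
  · exact Or.inr (Or.inl ⟨⟨rfl, rfl⟩, h⟩)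
  · exact Or.inr (Or.inr (Or.inl ⟨⟨rfl, by ring⟩, h⟩))
  · exact Or.inr (Or.inr (Or.inr ⟨⟨rfl, by ring⟩, h⟩))

theorem BondOpen.of_swap {ω : PercCfg} {u v : ℤ × ℤ} (h : BondOpen (ω ∘ bondSwap) u v) :
    BondOpen ω u.swap v.swap := by
  obtain ⟨u₁, u₂⟩ := u
  obtain ⟨v₁, v₂⟩ := v
  simp only [BondOpen, bondSwap, Function.comp_apply, Equiv.coe_fn_mk, Prod.mk.injEq,
    Prod.swap_prod_mk, Bool.not_true, Bool.not_false] at h ⊢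
  tauto

theorem BondOpen.symm {ω : PercCfg} {u v : ℤ × ℤ} (h : BondOpen ω u v) : BondOpen ω v u := by
  unfold BondOpen at *
  tauto

theorem OpenPathIn.of_shift {ω : PercCfg} {s a b c d : ℤ} {k : ℕ} {P : ℕ → ℤ × ℤ}
    (h : OpenPathIn (ω ∘ bondShift s) a b c d k P) :
    OpenPathIn ω a b (c + s) (d + s) k fun i => ((P i).1, (P i).2 + s) := by
  refine ⟨fun i hi => ?_, fun i hi => (h.2 i hi).of_shift⟩
  obtain ⟨h₁, h₂, h₃, h₄⟩ := h.1 i hi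
  exact ⟨h₁, h₂, by simpa using h₃, by simpa using h₄⟩

theorem IsBondPerc.measure_vCross_le_shift {Pr : Measure PercCfg} (hPr : IsBondPerc Pr)
    (s a b c d : ℤ) : Pr (VCross a b c d) ≤ Pr (VCross a b (c + s) (d + s)) := by
  refine (hPr.measure_comp (bondShift s) (.vCross a b c d)).symm.trans_le (measure_mono ?_)
  rintro ω ⟨k, P, hP, h₀, h₁⟩
  exact ⟨k, _, hP.of_shift, by simp [h₀], by simp [h₁]⟩

theorem IsBondPerc.measure_hCross_le_swap {Pr : Measure PercCfg} (hPr : IsBondPerc Pr)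
    (a b c d : ℤ) : Pr (HCross a b c d) ≤ Pr (VCross c d a b) := by
  refine (hPr.measure_comp bondSwap (.hCross a b c d)).symm.trans_le (measure_mono ?_)
  rintro ω ⟨k, P, hP, h₀, h₁⟩
  refine ⟨k, fun i => (P i).swap, ⟨fun i hi => ?_, fun i hi => (hP.2 i hi).of_swap⟩, h₀, h₁⟩
  obtain ⟨h₁, h₂, h₃, h₄⟩ := hP.1 i hi
  exact ⟨h₃, h₄, h₁, h₂⟩

/-- Grid adjacency, irrespective of the state of the bond. -/
theorem BondOpen.adj {ω : PercCfg} {u v : ℤ × ℤ} (h : BondOpen ω u v) :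
    (u.2 = v.2 ∧ (v.1 = u.1 + 1 ∨ u.1 = v.1 + 1)) ∨
      (u.1 = v.1 ∧ (v.2 = u.2 + 1 ∨ u.2 = v.2 + 1)) := by
  rcases h with ⟨h, _⟩ | ⟨h, _⟩ | ⟨h, _⟩ | ⟨h, _⟩ <;> rw [h] <;> simp

/-- The net number of upward steps of the path `Q 0, …, Q l` from below height `t` to height at
least `t`, made strictly to the left of the abscissa `x`. -/
def leftFlux (Q : ℕ → ℤ × ℤ) (l : ℕ) (x t : ℤ) : ℤ :=
  ∑ j ∈ Finset.range l, if (Q j).1 < x then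
    (if t ≤ (Q (j + 1)).2 then 1 else 0) - (if t ≤ (Q j).2 then 1 else 0) else 0

theorem leftFlux_add_one_left {ω : PercCfg} {Q : ℕ → ℤ × ℤ} {l : ℕ}
    (hQ : ∀ j < l, BondOpen ω (Q j) (Q (j + 1))) {x t : ℤ}
    (hx : (∀ j ≤ l, Q j ≠ (x, t)) ∨ ∀ j ≤ l, Q j ≠ (x, t - 1)) :
    leftFlux Q l (x + 1) t = leftFlux Q l x t := by
  refine Finset.sum_congr rfl fun j hj => ?_
  have hj := Finset.mem_range.1 hj
  have hadj := (hQ j hj).adj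
  simp only [ne_eq, Prod.ext_iff] at hx
  have hx' := hx.imp (fun h => And.intro (h j hj.le) (h (j + 1) hj))
    (fun h => And.intro (h j hj.le) (h (j + 1) hj))
  split_ifs <;> omega

theorem leftFlux_add_one_right {ω : PercCfg} {Q : ℕ → ℤ × ℤ} {l : ℕ}
    (hQ : ∀ j < l, BondOpen ω (Q j) (Q (j + 1))) {x t : ℤ} (hx : ∀ j ≤ l, Q j ≠ (x, t))
    (h₀ : (Q 0).2 ≠ t) (h₁ : (Q l).2 ≠ t) :
    leftFlux Q l x (t + 1) = leftFlux Q l x t := by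
  rw [← sub_eq_zero, leftFlux, leftFlux, ← Finset.sum_sub_distrib]
  have htel := Finset.sum_range_sub (fun j => if (Q j).1 < x ∧ (Q j).2 = t then (-1 : ℤ) else 0) l
  simp only [h₀, h₁, and_false, if_false, sub_zero] at htel
  rw [← htel]
  refine Finset.sum_congr rfl fun j hj => ?_
  have hj := Finset.mem_range.1 hj
  have hadj := (hQ j hj).adj
  have hx₀ := hx j hj.le
  have hx₁ := hx (j + 1) hj
  simp only [ne_eq, Prod.ext_iff] at hx₀ hx₁
  split_ifs <;> omega

/-- A horizontal and a vertical crossing of the same rectangle share a vertex. -/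
theorem exists_common_vertex {ω : PercCfg} {a b c d : ℤ} (hcd : c < d) {k l : ℕ}
    {P Q : ℕ → ℤ × ℤ} (hP : OpenPathIn ω a b c d k P) (hQ : OpenPathIn ω a b c d l Q)
    (hP₀ : (P 0).1 = a) (hP₁ : (P k).1 = b) (hQ₀ : (Q 0).2 = c) (hQ₁ : (Q l).2 = d) :
    ∃ i ≤ k, ∃ j ≤ l, P i = Q j := by
  by_contra! hne
  have hflux : ∀ i ≤ k, leftFlux Q l (P i).1 (min ((P i).2 + 1) d) = 0 := by
    intro i
    induction i with
    | zero =>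
      intro _
      refine Finset.sum_eq_zero fun j hj => if_neg ?_
      have := (hQ.1 j (Finset.mem_range.1 hj).le).1
      omega
    | succ i ih =>
      intro hi
      have ih := ih (by omega)
      have hu := hP.1 i (by omega)
      have hv := hP.1 (i + 1) hi
      have hadj := (hP.2 i hi).adj
      have hnu : ∀ j ≤ l, Q j ≠ P i := fun j hj h => hne i (by omega) j hj h.symm
      have hnv : ∀ j ≤ l, Q j ≠ P (i + 1) := fun j hj h => hne (i + 1) hi j hj h.symm
      generalize P i = u at *
      generalize P (i + 1) = v at *
      obtain ⟨u₁, u₂⟩ := u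
      obtain ⟨v₁, v₂⟩ := v
      simp only [InRect] at *
      have hrow : ∀ {x y : ℤ}, y ≤ d → (∀ j ≤ l, Q j ≠ (x, y)) →
          (∀ j ≤ l, Q j ≠ (x, min (y + 1) d)) ∨ ∀ j ≤ l, Q j ≠ (x, min (y + 1) d - 1) := by
        intro x y hy h
        rcases hy.lt_or_eq with hy | rfl
        · right
          rwa [min_eq_left (by omega), add_sub_cancel_right]
        · left
          rwa [min_eq_right (by omega)]
      rcases hadj with ⟨rfl, rfl | rfl⟩ | ⟨rfl, rfl | rfl⟩
      · rwa [leftFlux_add_one_left hQ.2 (hrow hu.2.2.2 hnu)]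
      · rwa [leftFlux_add_one_left hQ.2 (hrow hv.2.2.2 hnv)] at ih
      · rcases hv.2.2.2.lt_or_eq with hlt | heq
        · rw [min_eq_left (by omega)] at ih ⊢
          rwa [leftFlux_add_one_right hQ.2 hnv (by omega) (by omega)]
        · rwa [min_eq_right (by omega)] at ih ⊢
      · rcases hu.2.2.2.lt_or_eq with hlt | heq
        · rw [min_eq_left (by omega)] at ih ⊢
          rwa [leftFlux_add_one_right hQ.2 hnu (by omega) (by omega)] at ih
        · rwa [min_eq_right (by omega)] at ih ⊢
  have hzero := hflux k le_rfl
  have hk := hP.1 k le_rfl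
  have hnk : ∀ j ≤ l, P k ≠ Q j := hne k le_rfl
  simp only [InRect] at hk
  set t := min ((P k).2 + 1) d
  have hone : leftFlux Q l (P k).1 t = 1 := by
    have htel := Finset.sum_range_sub (fun j => if t ≤ (Q j).2 then (1 : ℤ) else 0) l
    rw [if_pos (by omega), if_neg (by omega), sub_zero] at htel
    rw [← htel]
    refine Finset.sum_congr rfl fun j hj => ?_
    have hj := Finset.mem_range.1 hj
    have hadj := (hQ.2 j hj).adj
    have hin := (hQ.1 j hj.le).2
    have hin' := (hQ.1 (j + 1) hj).2
    have h₀ := hnk j hj.le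
    have h₁ := hnk (j + 1) hj
    simp only [ne_eq, Prod.ext_iff] at h₀ h₁
    split_ifs <;> omega
  omega

/-- `u` and `v` are joined by an open path whose vertices have abscissa in `[a,b]`. -/
abbrev StripConn (ω : PercCfg) (a b : ℤ) : ℤ × ℤ → ℤ × ℤ → Prop :=
  Relation.ReflTransGen fun u v =>
    BondOpen ω u v ∧ (a ≤ u.1 ∧ u.1 ≤ b) ∧ (a ≤ v.1 ∧ v.1 ≤ b)

theorem StripConn.symm {ω : PercCfg} {a b : ℤ} {u v : ℤ × ℤ} (h : StripConn ω a b u v) :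
    StripConn ω a b v u := by
  induction h with
  | refl => exact .refl
  | tail _ h ih => exact ih.head ⟨h.1.symm, h.2.2, h.2.1⟩

theorem StripConn.of_path {ω : PercCfg} {a b : ℤ} {k : ℕ} {P : ℕ → ℤ × ℤ}
    (hin : ∀ i ≤ k, a ≤ (P i).1 ∧ (P i).1 ≤ b) (hP : ∀ i < k, BondOpen ω (P i) (P (i + 1)))
    {i j : ℕ} (hi : i ≤ k) (hj : j ≤ k) : StripConn ω a b (P i) (P j) := by
  have h0 : ∀ i ≤ k, StripConn ω a b (P 0) (P i) := by
    intro i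
    induction i with
    | zero => exact fun _ => .refl
    | succ i ih =>
      exact fun hi => (ih (by omega)).tail ⟨hP i hi, hin i (by omega), hin (i + 1) hi⟩
  exact (h0 i hi).symm.trans (h0 j hj)

theorem OpenPathIn.stripConn {ω : PercCfg} {a b c d : ℤ} {k : ℕ} {P : ℕ → ℤ × ℤ}
    (hP : OpenPathIn ω a b c d k P) {i j : ℕ} (hi : i ≤ k) (hj : j ≤ k) :
    StripConn ω a b (P i) (P j) :=
  .of_path (fun i hi => ⟨(hP.1 i hi).1, (hP.1 i hi).2.1⟩) hP.2 hi hj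

theorem OpenPathIn.cons {ω : PercCfg} {a b c d : ℤ} {k : ℕ} {P : ℕ → ℤ × ℤ}
    (hP : OpenPathIn ω a b c d k P) {u : ℤ × ℤ} (hu : InRect a b c d u) (h : BondOpen ω u (P 0)) :
    OpenPathIn ω a b c d (k + 1) fun i => i.casesOn u P := by
  refine ⟨fun i hi => ?_, fun i hi => ?_⟩
  · cases i with
    | zero => exact hu
    | succ i => exact hP.1 i (by omega)
  · cases i with
    | zero => exact h
    | succ i => exact hP.2 i (by omega)

/-- A path in a strip from height at most `c` to height at least `d` contains a vertical crossing
of the part of the strip between the heights `c` and `d`. -/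
theorem StripConn.mem_vCross {ω : PercCfg} {a b c d : ℤ} (hcd : c ≤ d) {u v : ℤ × ℤ}
    (h : StripConn ω a b u v) (hu : a ≤ u.1 ∧ u.1 ≤ b) (hc : u.2 ≤ c) (hd : d ≤ v.2) :
    ω ∈ VCross a b c d := by
  suffices H : (a ≤ u.1 ∧ u.1 ≤ b) → (u.2 ≤ c → ω ∈ VCross a b c d) ∧ (c ≤ u.2 → u.2 ≤ d →
      ω ∈ VCross a b c d ∨ ∃ k P, OpenPathIn ω a b c d k P ∧ P 0 = u ∧ (P k).2 = d) from
    (H hu).1 hc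
  have htriv : ∀ w : ℤ × ℤ, (a ≤ w.1 ∧ w.1 ≤ b) → w.2 = d →
      ∃ k P, OpenPathIn ω a b c d k P ∧ P 0 = w ∧ (P k).2 = d := fun w hw hwd =>
    ⟨0, fun _ => w, ⟨fun _ _ => ⟨hw.1, hw.2, hcd.trans hwd.ge, hwd.le⟩, by simp⟩, rfl, hwd⟩
  have hlow : ∀ w : ℤ × ℤ, (c ≤ w.2 → w.2 ≤ d →
      ω ∈ VCross a b c d ∨ ∃ k P, OpenPathIn ω a b c d k P ∧ P 0 = w ∧ (P k).2 = d) →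
      w.2 = c → ω ∈ VCross a b c d := by
    intro w H hw
    rcases H hw.ge (by omega) with H | ⟨k, P, hP, h₀, h₁⟩
    · exact H
    · exact ⟨k, P, hP, by rw [h₀, hw], h₁⟩
  clear hc hu
  induction h using Relation.ReflTransGen.head_induction_on with
  | refl =>
    intro hv
    have H : c ≤ v.2 → v.2 ≤ d →
        ω ∈ VCross a b c d ∨ ∃ k P, OpenPathIn ω a b c d k P ∧ P 0 = v ∧ (P k).2 = d :=
      fun _ h => Or.inr (htriv v hv (by omega))
    exact ⟨fun h => hlow v H (by omega), H⟩
  | @head u w huw _ ih =>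
    intro hu
    obtain ⟨hopen, -, hw⟩ := huw
    obtain ⟨ih₁, ih₂⟩ := ih hw
    have hadj := hopen.adj
    have H : c ≤ u.2 → u.2 ≤ d →
        ω ∈ VCross a b c d ∨ ∃ k P, OpenPathIn ω a b c d k P ∧ P 0 = u ∧ (P k).2 = d := by
      intro h₁ h₂
      by_cases hwc : w.2 ≤ c
      · exact Or.inl (ih₁ hwc)
      by_cases hwd : w.2 ≤ d
      · rcases ih₂ (by omega) hwd with h | ⟨k, P, hP, h₀, h₁'⟩
        · exact Or.inl h
        · exact Or.inr ⟨k + 1, _, hP.cons ⟨hu.1, hu.2, h₁, h₂⟩ (h₀ ▸ hopen), rfl, h₁'⟩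
      · exact Or.inr (htriv u hu (by omega))
    refine ⟨fun h => ?_, H⟩
    rcases h.lt_or_eq with h | h
    · exact ih₁ (by omega)
    · exact hlow u H h

/-- The squares `[0,n] × [a,a+n]` and `[0,n] × [a+h,a+n+h]` have open horizontal crossings joined
by an open path in the strip `0 ≤ x ≤ n`. -/
def JoinedSquares (n a h : ℤ) (ω : PercCfg) : Prop :=
  ∃ (k₁ k₂ k₃ : ℕ) (P₁ P₂ P₃ : ℕ → ℤ × ℤ),
    OpenPathIn ω 0 n a (a + n) k₁ P₁ ∧ (P₁ 0).1 = 0 ∧ (P₁ k₁).1 = n ∧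
    OpenPathIn ω 0 n (a + h) (a + n + h) k₂ P₂ ∧ (P₂ 0).1 = 0 ∧ (P₂ k₂).1 = n ∧
    (∀ i ≤ k₃, 0 ≤ (P₃ i).1 ∧ (P₃ i).1 ≤ n) ∧ (∀ i < k₃, BondOpen ω (P₃ i) (P₃ (i + 1))) ∧
    (∃ i ≤ k₁, P₃ 0 = P₁ i) ∧ ∃ j ≤ k₂, P₃ k₃ = P₂ j

open Witnessed in
theorem Witnessed.joined (n a h : ℤ) : Witnessed (JoinedSquares n a h) :=
  exists_of fun _ => exists_of fun _ => exists_of fun _ =>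
    exists_of fun _ => exists_of fun _ => exists_of fun _ =>
    (openPathIn _ _ _ _ _ _).and <| (const _).and <| (const _).and <|
    (openPathIn _ _ _ _ _ _).and <| (const _).and <| (const _).and <| (const _).and <|
    (forall_lt (fun _ => bondOpen _ _) _).and (const _)

theorem IsBondPerc.measure_joined_le_shift {Pr : Measure PercCfg} (hPr : IsBondPerc Pr)
    (s n a h : ℤ) : Pr {ω | JoinedSquares n a h ω} ≤ Pr {ω | JoinedSquares n (a + s) h ω} := by
  refine (hPr.measure_comp (bondShift s) (.joined n a h)).symm.trans_le (measure_mono ?_)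
  rintro ω ⟨k₁, k₂, k₃, P₁, P₂, P₃, h₁, h₁₀, h₁₁, h₂, h₂₀, h₂₁, h₃, h₃', ⟨i, hi, hPi⟩, j, hj, hPj⟩
  refine ⟨k₁, k₂, k₃, fun i => ((P₁ i).1, (P₁ i).2 + s), fun i => ((P₂ i).1, (P₂ i).2 + s),
    fun i => ((P₃ i).1, (P₃ i).2 + s), ?_, h₁₀, h₁₁, ?_, h₂₀, h₂₁, h₃,
    fun i hi => (h₃' i hi).of_shift, ⟨i, hi, by simp [hPi]⟩, j, hj, by simp [hPj]⟩
  · convert h₁.of_shift using 1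
    ring
  · convert h₂.of_shift using 1 <;> ring

theorem JoinedSquares.hCross {n a h : ℤ} {ω : PercCfg} (H : JoinedSquares n a h ω) :
    ω ∈ HCross 0 n a (a + n) := by
  obtain ⟨k₁, -, -, P₁, -, -, h₁, h₁₀, h₁₁, -⟩ := H
  exact ⟨k₁, P₁, h₁, h₁₀, h₁₁⟩

/-- Vertical crossings of the squares chain successive joined pairs of crossings together. -/
theorem exists_crossing_stripConn {n h : ℤ} (hn : 0 < n) {ω : PercCfg} {m : ℕ}
    (hJ : ∀ i < m, JoinedSquares n (i * h) h ω ∧ ω ∈ VCross 0 n (i * h) (i * h + n)) (hm : 0 < m) :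
    ∃ u k P, (0 ≤ u.1 ∧ u.1 ≤ n) ∧ u.2 ≤ n ∧ OpenPathIn ω 0 n (m * h) (m * h + n) k P ∧
      (P 0).1 = 0 ∧ (P k).1 = n ∧ StripConn ω 0 n u (P 0) := by
  induction m with
  | zero => exact absurd hm (lt_irrefl 0)
  | succ m ih =>
    obtain ⟨⟨k₁, k₂, k₃, P₁, P₂, P₃, h₁, h₁₀, h₁₁, h₂, h₂₀, h₂₁, h₃, h₃', ⟨i, hi, hPi⟩, j, hj, hPj⟩,
      l, Q, hQ, hQ₀, hQ₁⟩ := hJ m (Nat.lt_succ_self m)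
    have hnext : OpenPathIn ω 0 n ((m + 1 : ℕ) * h) ((m + 1 : ℕ) * h + n) k₂ P₂ := by
      convert h₂ using 1 <;> push_cast <;> ring
    have h₁₂ : StripConn ω 0 n (P₁ 0) (P₂ 0) := by
      have h := StripConn.of_path h₃ h₃' (Nat.zero_le k₃) le_rfl
      rw [hPi, hPj] at h
      exact ((h₁.stripConn (Nat.zero_le _) hi).trans h).trans (h₂.stripConn hj (Nat.zero_le _))
    rcases Nat.eq_zero_or_pos m with rfl | hm'
    · have hin := h₁.1 0 (Nat.zero_le _)
      refine ⟨P₁ 0, k₂, P₂, ⟨hin.1, hin.2.1⟩, ?_, hnext, h₂₀, h₂₁, h₁₂⟩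
      simpa using hin.2.2.2
    · obtain ⟨u, k, P, hu, hu', hP, hP₀, hP₁, huP⟩ := ih (fun i hi => hJ i (by omega)) hm'
      refine ⟨u, k₂, P₂, hu, hu', hnext, h₂₀, h₂₁, ?_⟩
      have hlt : (m * h : ℤ) < m * h + n := by omega
      obtain ⟨p, hp, q, hq, hpq⟩ := exists_common_vertex hlt hP hQ hP₀ hP₁ hQ₀ hQ₁
      obtain ⟨p', hp', q', hq', hpq'⟩ := exists_common_vertex hlt h₁ hQ h₁₀ h₁₁ hQ₀ hQ₁
      have hPQ : StripConn ω 0 n (P 0) (Q q) := hpq ▸ hP.stripConn (Nat.zero_le _) hp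
      have hQP : StripConn ω 0 n (Q q') (P₁ 0) := hpq' ▸ h₁.stripConn hp' (Nat.zero_le _)
      exact (((huP.trans hPQ).trans (hQ.stripConn hq hq')).trans hQP).trans h₁₂

/-- **Joined crossings of overlapping squares yield long vertical crossings**
(Lemma 5.5): for every `ε ∈ (0,1]` and `c' > 0` there is `c > 0` such that for
every `n ≥ 1`, with `h = ⌈εn⌉`, `S₁ = [0,n]×[0,n]` and `S₂ = [0,n]×[h,n+h]`:
if the event `J(S₁,S₂)` — that there are open horizontal crossings `P₁` of `S₁`
and `P₂` of `S₂` joined by an open lattice path whose vertices have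
`x`-coordinate between `0` and `n` (possibly `P₁` and `P₂` share a vertex) —
has probability at least `c'`, then `Pr(V([0,n]×[0,100n])) ≥ c`. -/
theorem joined_crossings_to_long_vertical (ε : ℝ) (hε0 : 0 < ε) (hε1 : ε ≤ 1)
    (c' : ENNReal) (hc' : 0 < c') :
    ∃ c : ENNReal, 0 < c ∧
      ∀ Pr : Measure PercCfg, IsBondPerc Pr →
        ∀ (n : ℕ), 1 ≤ n →
          c' ≤ Pr {ω | ∃ (k₁ k₂ k₃ : ℕ) (P₁ P₂ P₃ : ℕ → ℤ × ℤ),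
              OpenPathIn ω 0 (n : ℤ) 0 (n : ℤ) k₁ P₁ ∧
                (P₁ 0).1 = 0 ∧ (P₁ k₁).1 = (n : ℤ) ∧
              OpenPathIn ω 0 (n : ℤ) ⌈ε * (n : ℝ)⌉ ((n : ℤ) + ⌈ε * (n : ℝ)⌉) k₂ P₂ ∧
                (P₂ 0).1 = 0 ∧ (P₂ k₂).1 = (n : ℤ) ∧
              (∀ i ≤ k₃, 0 ≤ (P₃ i).1 ∧ (P₃ i).1 ≤ (n : ℤ)) ∧
              (∀ i < k₃, BondOpen ω (P₃ i) (P₃ (i + 1))) ∧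
              (∃ i ≤ k₁, P₃ 0 = P₁ i) ∧ (∃ j ≤ k₂, P₃ k₃ = P₂ j)} →
          c ≤ Pr (VCross 0 (n : ℤ) 0 (100 * (n : ℤ))) := by
  refine ⟨(c' * c') ^ ⌈101 / ε⌉₊, ENNReal.pow_pos (ENNReal.mul_pos hc'.ne' hc'.ne') _, ?_⟩
  intro Pr hPr n hn hJ
  set h : ℤ := ⌈ε * (n : ℝ)⌉
  set K : ℕ := ⌈101 / ε⌉₊
  have hJ₀ : c' ≤ Pr {ω | JoinedSquares n 0 h ω} := by simpa only [JoinedSquares, zero_add] using hJ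
  have hJs : ∀ s : ℤ, c' ≤ Pr {ω | JoinedSquares n s h ω} := fun s => by
    simpa using hJ₀.trans (hPr.measure_joined_le_shift s n 0 h)
  have hVs : ∀ s : ℤ, c' ≤ Pr (VCross 0 n s (s + n)) := fun s => by
    have hH : c' ≤ Pr (HCross 0 n 0 n) := hJ₀.trans <| measure_mono fun ω hω => by
      simpa using JoinedSquares.hCross hω
    have hV := (hH.trans (hPr.measure_hCross_le_swap 0 n 0 n)).trans
      (hPr.measure_vCross_le_shift s 0 n 0 n)
    rwa [zero_add, add_comm (n : ℤ) s] at hV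
  have hpos : 0 < K := Nat.ceil_pos.2 (by positivity)
  have hheight : (101 * n : ℤ) ≤ K * h := by
    have h₁ : 101 / ε ≤ K := Nat.le_ceil _
    have h₂ : ε * n ≤ h := Int.le_ceil _
    have h₃ : (101 * n : ℝ) ≤ K * h := by
      calc (101 * n : ℝ) = 101 / ε * (ε * n) := by field_simp
        _ ≤ K * h := by gcongr
    exact_mod_cast h₃
  have hchain := hPr.harris_forall_lt (c := c' * c')
    (p := fun i ω => JoinedSquares n (i * h) h ω ∧ ω ∈ VCross 0 n (i * h) (i * h + n))
    (fun i => (Witnessed.joined _ _ _).and (.vCross _ _ _ _))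
    (fun i => (mul_le_mul' (hJs _) (hVs _)).trans
      (hPr.harris (.joined _ _ _) (.vCross _ _ _ _))) K
  have hlong : Pr (VCross 0 n n (101 * n)) ≤ Pr (VCross 0 n 0 (100 * n)) := by
    have := hPr.measure_vCross_le_shift (-n) 0 n n (101 * n)
    rwa [add_neg_cancel, show (101 * n + -n : ℤ) = 100 * n by ring] at this
  refine (hchain.trans (measure_mono fun ω hω => ?_)).trans hlong
  obtain ⟨u, k, P, hu, hu', hP, -, -, huP⟩ := exists_crossing_stripConn (by omega) hω hpos
  exact huP.mem_vCross (by omega) hu hu' (hheight.trans (hP.1 0 (Nat.zero_le _)).2.2.1)
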